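/- Suppose (u, v, b, p) is a smooth solution of the Eady–Boussinesq vertical slice equations on Ω for t in an open interval I. Then the total energy E = K_u + K_v + P is constant on I, i.e. dE/dt (t) = 0 for every t ∈ I. -/

import Mathlib

open MeasureTheory

/-- Partial derivative in the `x`-direction of a scalar field on the vertical slice. -/
noncomputable def pdx (g : ℝ × ℝ → ℝ) (p : ℝ × ℝ) : ℝ := fderiv ℝ g p (1, 0)

/-- Partial derivative in the `z`-direction of a scalar field on the vertical slice. -/
noncomputable def pdz (g : ℝ × ℝ → ℝ) (p : ℝ × ℝ) : ℝ := fderiv ℝ g p (0, 1)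

/-- The vertical slice domain `Ω = [−L, L] × [0, H]`. -/
def Omega (L H : ℝ) : Set (ℝ × ℝ) := Set.Icc (-L, 0) (L, H)

/-- A smooth solution of the Eady–Boussinesq vertical slice equations on `Ω = [−L,L]×[0,H]`
for times `t ∈ I`, with constants `ρ₀` (reference density), `f` (Coriolis parameter),
`N2` (squared Brunt–Väisälä frequency) and `bY = ∂b̄/∂y` (constant background buoyancy
gradient).  All fields are smooth, `2L`-periodic in `x`, and the in-slice velocity
satisfies the rigid-lid conditions `u₂ = 0` at `z = 0` and `z = H`. -/
structure EadySolution (L H ρ₀ f N2 bY : ℝ) (I : Set ℝ) where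
  /-- in-slice velocity `u = (u₁, u₂)`, a function of time and of the point `(x, z)` -/
  u : ℝ → ℝ × ℝ → ℝ × ℝ
  /-- out-of-slice velocity `v` -/
  v : ℝ → ℝ × ℝ → ℝ
  /-- buoyancy `b` -/
  b : ℝ → ℝ × ℝ → ℝ
  /-- pressure `p` -/
  p : ℝ → ℝ × ℝ → ℝ
  smooth_u : ContDiff ℝ (⊤ : ℕ∞) fun q : ℝ × (ℝ × ℝ) => u q.1 q.2
  smooth_v : ContDiff ℝ (⊤ : ℕ∞) fun q : ℝ × (ℝ × ℝ) => v q.1 q.2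
  smooth_b : ContDiff ℝ (⊤ : ℕ∞) fun q : ℝ × (ℝ × ℝ) => b q.1 q.2
  smooth_p : ContDiff ℝ (⊤ : ℕ∞) fun q : ℝ × (ℝ × ℝ) => p q.1 q.2
  periodic_u : ∀ t x z : ℝ, u t (x + 2 * L, z) = u t (x, z)
  periodic_v : ∀ t x z : ℝ, v t (x + 2 * L, z) = v t (x, z)
  periodic_b : ∀ t x z : ℝ, b t (x + 2 * L, z) = b t (x, z)
  periodic_p : ∀ t x z : ℝ, p t (x + 2 * L, z) = p t (x, z)
  /-- rigid lid on the lower boundary: `u·ẑ = 0` at `z = 0` -/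
  rigid_bot : ∀ t x : ℝ, (u t (x, 0)).2 = 0
  /-- rigid lid on the upper boundary: `u·ẑ = 0` at `z = H` -/
  rigid_top : ∀ t x : ℝ, (u t (x, H)).2 = 0
  /-- `x̂`-component of `∂u/∂t + (u·∇)u − f v x̂ = −(1/ρ₀)∇p + b ẑ` -/
  mom_x : ∀ t ∈ I, ∀ pt ∈ Omega L H,
    deriv (fun s => (u s pt).1) t
      + (u t pt).1 * pdx (fun q => (u t q).1) pt
      + (u t pt).2 * pdz (fun q => (u t q).1) pt
      - f * v t pt
    = -(1 / ρ₀) * pdx (p t) pt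
  /-- `ẑ`-component of `∂u/∂t + (u·∇)u − f v x̂ = −(1/ρ₀)∇p + b ẑ` -/
  mom_z : ∀ t ∈ I, ∀ pt ∈ Omega L H,
    deriv (fun s => (u s pt).2) t
      + (u t pt).1 * pdx (fun q => (u t q).2) pt
      + (u t pt).2 * pdz (fun q => (u t q).2) pt
    = -(1 / ρ₀) * pdz (p t) pt + b t pt
  /-- `∂v/∂t + u·∇v + f u₁ = −b̄_y (z − H/2)` -/
  mom_v : ∀ t ∈ I, ∀ pt ∈ Omega L H,
    deriv (fun s => v s pt) t
      + (u t pt).1 * pdx (v t) pt + (u t pt).2 * pdz (v t) pt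
      + f * (u t pt).1
    = -bY * (pt.2 - H / 2)
  /-- `∂b/∂t + u·∇b + b̄_y v + N² u₂ = 0` -/
  buoy : ∀ t ∈ I, ∀ pt ∈ Omega L H,
    deriv (fun s => b s pt) t
      + (u t pt).1 * pdx (b t) pt + (u t pt).2 * pdz (b t) pt
      + bY * v t pt + N2 * (u t pt).2
    = 0
  /-- incompressibility `∇·u = 0` -/
  incomp : ∀ t ∈ I, ∀ pt ∈ Omega L H,
    pdx (fun q => (u t q).1) pt + pdz (fun q => (u t q).2) pt = 0

/-- In-slice kinetic energy `K_u(t) = ρ₀ ∫_Ω ½|u|² dx dz`. -/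
noncomputable def Ku (L H ρ₀ : ℝ) (u : ℝ → ℝ × ℝ → ℝ × ℝ) (t : ℝ) : ℝ :=
  ρ₀ * ∫ pt in Omega L H, (1 / 2) * ((u t pt).1 ^ 2 + (u t pt).2 ^ 2)

/-- Out-of-slice kinetic energy `K_v(t) = ρ₀ ∫_Ω ½ v² dx dz`. -/
noncomputable def Kv (L H ρ₀ : ℝ) (v : ℝ → ℝ × ℝ → ℝ) (t : ℝ) : ℝ :=
  ρ₀ * ∫ pt in Omega L H, (1 / 2) * (v t pt) ^ 2

/-- Potential energy `P(t) = −ρ₀ ∫_Ω b (z − H/2) dx dz`. -/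
noncomputable def Pe (L H ρ₀ : ℝ) (b : ℝ → ℝ × ℝ → ℝ) (t : ℝ) : ℝ :=
  -(ρ₀ * ∫ pt in Omega L H, b t pt * (pt.2 - H / 2))

/-- The integral of `U · ∇G` over the slice vanishes for a divergence-free velocity `U` with
rigid lids and fields that agree on the two lateral boundaries. -/
theorem setIntegral_fderiv_apply_eq_zero {L H : ℝ} (hL : 0 ≤ L) (hH : 0 ≤ H)
    {U : ℝ × ℝ → ℝ × ℝ} {G : ℝ × ℝ → ℝ} (hU : ContDiff ℝ 1 U) (hG : ContDiff ℝ 1 G)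
    (hUper : ∀ z, U (L, z) = U (-L, z)) (hGper : ∀ z, G (L, z) = G (-L, z))
    (hbot : ∀ x, (U (x, 0)).2 = 0) (htop : ∀ x, (U (x, H)).2 = 0)
    (hdiv : ∀ q ∈ Omega L H,
      pdx (fun q => (U q).1) q + pdz (fun q => (U q).2) q = 0) :
    ∫ q in Omega L H, fderiv ℝ G q (U q) = 0 := by
  have h1 : ContDiff ℝ 1 fun q => (U q).1 * G q := by fun_prop
  have h2 : ContDiff ℝ 1 fun q => (U q).2 * G q := by fun_prop
  have key := integral_divergence_prod_Icc_of_hasFDerivAt_of_le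
    (fun q => (U q).1 * G q) (fun q => (U q).2 * G q)
    (fderiv ℝ fun q => (U q).1 * G q) (fderiv ℝ fun q => (U q).2 * G q)
    (-L, 0) (L, H) ⟨by simp; linarith, by simpa using hH⟩
    h1.continuous.continuousOn h2.continuous.continuousOn
    (fun q _ => (h1.differentiable (by simp) q).hasFDerivAt)
    (fun q _ => (h2.differentiable (by simp) q).hasFDerivAt)
    (by
      refine ContinuousOn.integrableOn_compact isCompact_Icc (Continuous.continuousOn ?_)
      have := h1.continuous_fderiv (by simp)
      have := h2.continuous_fderiv (by simp)
      fun_prop)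
  simp only [hUper, hGper, hbot, htop, zero_mul, intervalIntegral.integral_zero, sub_self,
    zero_add] at key
  rw [← key]
  refine setIntegral_congr_fun measurableSet_Icc fun q hq => ?_
  have hU1 : DifferentiableAt ℝ (fun q => (U q).1) q :=
    (hU.fst.differentiable (by simp)) q
  have hU2 : DifferentiableAt ℝ (fun q => (U q).2) q :=
    (hU.snd.differentiable (by simp)) q
  have hGd : DifferentiableAt ℝ G q := hG.differentiable (by simp) q
  have hd := hdiv q hq
  have hsplit : fderiv ℝ G q (U q)
      = (U q).1 * fderiv ℝ G q (1, 0) + (U q).2 * fderiv ℝ G q (0, 1) := by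
    conv_lhs => rw [show U q = (U q).1 • ((1, 0) : ℝ × ℝ) + (U q).2 • ((0, 1) : ℝ × ℝ) by
      ext <;> simp]
    rw [map_add, map_smul, map_smul, smul_eq_mul, smul_eq_mul]
  simp only [pdx, pdz] at hd
  simp only [fderiv_fun_mul hU1 hGd, fderiv_fun_mul hU2 hGd, add_apply,
    smul_apply, smul_eq_mul]
  rw [hsplit]
  linear_combination (-G q) * hd

/-- Differentiation under the integral sign over a compact set for a `C¹` integrand. -/
theorem hasDerivAt_setIntegral_of_contDiff {E : Type*} [NormedAddCommGroup E] [NormedSpace ℝ E]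
    [MeasurableSpace E] [OpensMeasurableSpace E] {μ : Measure E} [IsFiniteMeasureOnCompacts μ]
    {K : Set E} (hK : IsCompact K) (hKm : MeasurableSet K)
    {F : ℝ → E → ℝ} (hF : ContDiff ℝ 1 fun q : ℝ × E => F q.1 q.2) (t : ℝ) :
    HasDerivAt (fun s => ∫ x in K, F s x ∂μ) (∫ x in K, deriv (fun s => F s x) t ∂μ) t := by
  have hd : ∀ s x, HasDerivAt (fun s => F s x)
      (fderiv ℝ (fun q : ℝ × E => F q.1 q.2) (s, x) (1, 0)) s := fun s x =>
    (hF.differentiable (by simp) (s, x)).hasFDerivAt.comp_hasDerivAt (f := fun s => (s, x)) s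
      ((hasDerivAt_id s).prodMk (hasDerivAt_const s x))
  have hcont : Continuous fun q : ℝ × E => deriv (fun s => F s q.2) q.1 := by
    simp only [(hd _ _).deriv]
    have := hF.continuous_fderiv (by simp)
    fun_prop
  have hFc : ∀ s, Continuous (F s) := fun s =>
    hF.continuous.comp (by fun_prop : Continuous fun x => (s, x))
  obtain ⟨C, hC⟩ := ((isCompact_Icc (a := t - 1) (b := t + 1)).prod hK).exists_bound_of_continuousOn
    hcont.continuousOn
  refine (hasDerivAt_integral_of_dominated_loc_of_deriv_le (bound := fun _ => C)
    (F' := fun s x => deriv (fun s => F s x) s)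
    (Icc_mem_nhds (by linarith : t - 1 < t) (by linarith : t < t + 1))
    (Filter.Eventually.of_forall fun s => ?_) ?_ ?_ ?_ ?_ ?_).2
  · exact (hFc s).continuousOn.aestronglyMeasurable_of_isCompact hK hKm
  · exact (hFc t).continuousOn.integrableOn_compact' hK hKm
  · exact (hcont.comp (by fun_prop : Continuous fun x => (t, x))).continuousOn
      |>.aestronglyMeasurable_of_isCompact hK hKm
  · exact (ae_restrict_iff' hKm).2 (Filter.Eventually.of_forall fun x hx s hs => hC (s, x) ⟨hs, hx⟩)
  · exact integrableOn_const hK.measure_lt_top.ne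
  · exact Filter.Eventually.of_forall fun x s _ => (hd s x).differentiableAt.hasDerivAt

/-- For a smooth solution of the Eady–Boussinesq vertical slice equations on `Ω` for `t` in
an open interval `I = (a, c)`, the total energy `E = K_u + K_v + P` is constant on `I`:
`dE/dt (t) = 0` for every `t ∈ I`. -/
theorem totalEnergy_hasDerivAt_zero (L H ρ₀ f N2 bY a c : ℝ)
    (hL : 0 < L) (hH : 0 < H) (hρ : 0 < ρ₀)
    (sol : EadySolution L H ρ₀ f N2 bY (Set.Ioo a c)) :
    ∀ t ∈ Set.Ioo a c,
      HasDerivAt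
        (fun s => Ku L H ρ₀ sol.u s + Kv L H ρ₀ sol.v s + Pe L H ρ₀ sol.b s) 0 t := by
  intro t ht
  have hu : ContDiff ℝ 1 fun q : ℝ × (ℝ × ℝ) => sol.u q.1 q.2 := sol.smooth_u.of_le (by simp)
  have hv : ContDiff ℝ 1 fun q : ℝ × (ℝ × ℝ) => sol.v q.1 q.2 := sol.smooth_v.of_le (by simp)
  have hb : ContDiff ℝ 1 fun q : ℝ × (ℝ × ℝ) => sol.b q.1 q.2 := sol.smooth_b.of_le (by simp)
  have hp : ContDiff ℝ 1 fun q : ℝ × (ℝ × ℝ) => sol.p q.1 q.2 := sol.smooth_p.of_le (by simp)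
  have hut : ∀ s, ContDiff ℝ 1 (sol.u s) := fun s => hu.comp (contDiff_prodMk_right s)
  have hvt : ∀ s, ContDiff ℝ 1 (sol.v s) := fun s => hv.comp (contDiff_prodMk_right s)
  have hbt : ∀ s, ContDiff ℝ 1 (sol.b s) := fun s => hb.comp (contDiff_prodMk_right s)
  have hpt : ∀ s, ContDiff ℝ 1 (sol.p s) := fun s => hp.comp (contDiff_prodMk_right s)
  have hint : ∀ {g : ℝ × ℝ → ℝ}, ContDiff ℝ 1 g → IntegrableOn g (Omega L H) := fun hg =>
    hg.continuous.continuousOn.integrableOn_compact isCompact_Icc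
  let e : ℝ → ℝ × ℝ → ℝ := fun s q =>
    (1 / 2) * ((sol.u s q).1 ^ 2 + (sol.u s q).2 ^ 2) + (1 / 2) * (sol.v s q) ^ 2
      - sol.b s q * (q.2 - H / 2)
  let G : ℝ × ℝ → ℝ := fun q =>
    sol.b t q * (q.2 - H / 2) + N2 / 2 * (q.2 - H / 2) ^ 2
      - ((1 / 2) * ((sol.u t q).1 ^ 2 + (sol.u t q).2 ^ 2) + (1 / 2) * (sol.v t q) ^ 2
        + 1 / ρ₀ * sol.p t q)
  have he : ContDiff ℝ 1 fun q : ℝ × (ℝ × ℝ) => e q.1 q.2 := by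
    simp only [e]; fun_prop
  have hG : ContDiff ℝ 1 G := by
    have := hut t
    have := hvt t
    have := hbt t
    have := hpt t
    simp only [G]; fun_prop
  have hE : (fun s => Ku L H ρ₀ sol.u s + Kv L H ρ₀ sol.v s + Pe L H ρ₀ sol.b s)
      = fun s => ρ₀ * ∫ q in Omega L H, e s q := by
    funext s
    have hus := hut s
    have hvs := hvt s
    have hbs := hbt s
    simp only [Ku, Kv, Pe, e]
    rw [integral_sub (hint (by fun_prop)) (hint (by fun_prop)),
      integral_add (hint (by fun_prop)) (hint (by fun_prop))]
    ring
  have hflux : ∀ q ∈ Omega L H, deriv (fun s => e s q) t = fderiv ℝ G q (sol.u t q) := by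
    intro q hq
    have ht' : ContDiff ℝ 1 fun s : ℝ => (s, q) := by fun_prop
    have hu' : ContDiff ℝ 1 fun s => sol.u s q := hu.comp ht'
    have du1 := ((hu'.fst).differentiable (by simp) t).hasDerivAt
    have du2 := ((hu'.snd).differentiable (by simp) t).hasDerivAt
    have dv := ((hv.comp ht').differentiable (by simp) t).hasDerivAt
    have db := ((hb.comp ht').differentiable (by simp) t).hasDerivAt
    have de : HasDerivAt (fun s => e s q) _ t :=
      ((((du1.pow 2).add (du2.pow 2)).const_mul (1 / 2)).add ((dv.pow 2).const_mul (1 / 2))).sub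
        (db.mul_const (q.2 - H / 2))
    have gu1 := ((hut t).fst.differentiable (by simp) q).hasFDerivAt
    have gu2 := ((hut t).snd.differentiable (by simp) q).hasFDerivAt
    have gv := ((hvt t).differentiable (by simp) q).hasFDerivAt
    have gb := ((hbt t).differentiable (by simp) q).hasFDerivAt
    have gp := ((hpt t).differentiable (by simp) q).hasFDerivAt
    have gz : HasFDerivAt (fun q : ℝ × ℝ => q.2 - H / 2) (ContinuousLinearMap.snd ℝ ℝ ℝ) q :=
      hasFDerivAt_snd.sub_const _
    have gG : HasFDerivAt G _ q :=
      ((gb.mul gz).add ((gz.pow 2).const_mul (N2 / 2))).sub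
        (((((gu1.pow 2).add (gu2.pow 2)).const_mul (1 / 2)).add
          ((gv.pow 2).const_mul (1 / 2))).add (gp.const_mul (1 / ρ₀)))
    have hsplit : ∀ A : ℝ × ℝ →L[ℝ] ℝ,
        A (sol.u t q) = (sol.u t q).1 * A (1, 0) + (sol.u t q).2 * A (0, 1) := fun A => by
      conv_lhs => rw [show sol.u t q = (sol.u t q).1 • ((1, 0) : ℝ × ℝ)
        + (sol.u t q).2 • ((0, 1) : ℝ × ℝ) by ext <;> simp]
      rw [map_add, map_smul, map_smul, smul_eq_mul, smul_eq_mul]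
    have e1 := sol.mom_x t ht q hq
    have e2 := sol.mom_z t ht q hq
    have e3 := sol.mom_v t ht q hq
    have e4 := sol.buoy t ht q hq
    simp only [pdx, pdz] at e1 e2 e3 e4
    rw [de.deriv, gG.fderiv, hsplit]
    simp [-one_div]
    simp only [Function.comp_def]
    linear_combination (sol.u t q).1 * e1 + (sol.u t q).2 * e2 + sol.v t q * e3
      - (q.2 - H / 2) * e4
  have hper : ∀ z : ℝ, (L, z) = (-L + 2 * L, z) := fun z => by ring_nf
  have hzero : ∫ q in Omega L H, deriv (fun s => e s q) t = 0 := by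
    rw [setIntegral_congr_fun (s := Omega L H) measurableSet_Icc hflux]
    refine setIntegral_fderiv_apply_eq_zero hL.le hH.le (hut t) hG (fun z => ?_) (fun z => ?_)
      (sol.rigid_bot t) (sol.rigid_top t) (sol.incomp t ht)
    · rw [hper, sol.periodic_u]
    · simp only [G]
      rw [hper, sol.periodic_u, sol.periodic_v, sol.periodic_b, sol.periodic_p]
  rw [hE]
  have := (hasDerivAt_setIntegral_of_contDiff (μ := volume) (K := Omega L H) isCompact_Icc
    measurableSet_Icc he t).const_mul ρ₀
  rwa [hzero, mul_zero] at this
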